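/- Let R be a commutative ring and f ∈ R[X] a monic polynomial of degree d > 0, and let g ∈ R[Y] be the reversed polynomial g(Y) = Y^d · f(1/Y). Then there is an R-algebra isomorphism between the localization R[X]_{X·f} of R[X] away from X·f and the localization R[Y]_{Y·g} of R[Y] away from Y·g, which sends the image of X to the inverse of the image of Y. -/

import Mathlib

open Polynomial in
/-- If `u` is a unit, the reverse of `f` evaluated at `u⁻¹` is a unit if and only if
`f` evaluated at `u` is. -/
theorem isUnit_aeval_reverse_inv_iff {R A : Type*} [CommRing R] [CommRing A] [Algebra R A]
    (f : R[X]) (u : Aˣ) :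
    IsUnit (aeval (↑u⁻¹ : A) f.reverse) ↔ IsUnit (aeval (u : A) f) := by
  let := u.invertible
  have h := eval₂_reverse_mul_pow (algebraMap R A) (u : A) f
  rw [invOf_units] at h
  rw [aeval_def, aeval_def, ← h, IsUnit.mul_iff]
  exact ⟨fun h' => ⟨h', u.isUnit.pow _⟩, fun h' => h'.1⟩

open Polynomial in
/-- There is an `R`-algebra map out of `R[X]` localized away from `X * f` sending `X` to any unit `v`
at which `f` takes an invertible value. -/
theorem exists_algHom_away_X_mul {R B : Type*} [CommRing R] [CommRing B] [Algebra R B]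
    (f : R[X]) (v : Bˣ) (h : IsUnit (aeval (v : B) f)) :
    ∃ φ : Localization.Away (X * f) →ₐ[R] B, φ (algebraMap R[X] _ X) = v := by
  have hu : IsUnit (aeval (R := R) (v : B) (X * f)) := by
    rw [map_mul, aeval_X]
    exact v.isUnit.mul h
  refine ⟨IsLocalization.Away.liftAlgHom (X * f) (f := aeval (v : B)) hu, ?_⟩
  rw [IsLocalization.Away.liftAlgHom_apply, IsLocalization.Away.lift_eq]
  exact aeval_X _

open Polynomial in
/-- An `R`-algebra endomorphism of a localization of `R[X]` fixing the image of `X` is the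
identity. -/
theorem algHom_away_eq_id {R : Type*} [CommRing R] (p : R[X])
    (φ : Localization.Away p →ₐ[R] Localization.Away p)
    (h : φ (algebraMap R[X] _ X) = algebraMap R[X] _ X) : φ = AlgHom.id R _ := by
  refine IsLocalization.algHom_ext (Submonoid.powers p) ?_
  exact Polynomial.algHom_ext h

open Polynomial in
/-- The image of `X` in `R[X]` localized away from `X * p` as a unit, with `p` a unit there. -/
theorem exists_unit_away_X_mul {R : Type*} [CommRing R] (p : R[X]) :
    ∃ u : (Localization.Away (X * p))ˣ,
      (u : Localization.Away (X * p)) = algebraMap R[X] _ X ∧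
        IsUnit (aeval (u : Localization.Away (X * p)) p) := by
  obtain ⟨u, hu⟩ := IsLocalization.Away.isUnit_of_dvd (S := Localization.Away (X * p))
    (X * p) (dvd_mul_right X p)
  refine ⟨u, hu, ?_⟩
  rw [hu, aeval_algebraMap_apply, aeval_X_left_apply]
  exact IsLocalization.Away.isUnit_of_dvd (X * p) (dvd_mul_left p X)

/-- Let `R` be a commutative ring, `f ∈ R[X]` monic of degree `d > 0`, and let
`g ∈ R[Y]` be the reversed polynomial `g(Y) = Y^d · f(1/Y)`. Then there is an
`R`-algebra isomorphism `R[X]_{X·f} ≃ R[Y]_{Y·g}` sending the image of `X` to the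
inverse of the image of `Y`. -/
theorem localization_away_iso_reverse (R : Type*) [CommRing R] (f : Polynomial R)
    (hf : f.Monic) (hdeg : 0 < f.natDegree) :
    ∃ e : Localization.Away (Polynomial.X * f) ≃ₐ[R]
        Localization.Away (Polynomial.X * f.reverse),
      e (algebraMap (Polynomial R) (Localization.Away (Polynomial.X * f)) Polynomial.X) *
        algebraMap (Polynomial R) (Localization.Away (Polynomial.X * f.reverse))
          Polynomial.X = 1 := by
  obtain ⟨u, hu, huf⟩ := exists_unit_away_X_mul f
  obtain ⟨v, hv, hvg⟩ := exists_unit_away_X_mul f.reverse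
  obtain ⟨φ, hφ⟩ := exists_algHom_away_X_mul f v⁻¹
    ((isUnit_aeval_reverse_inv_iff f v⁻¹).1 (by rwa [inv_inv]))
  obtain ⟨ψ, hψ⟩ := exists_algHom_away_X_mul f.reverse u⁻¹
    ((isUnit_aeval_reverse_inv_iff f u).2 huf)
  rw [← hu] at hφ
  rw [← hv] at hψ
  have hφ' : φ ↑u⁻¹ = v := by
    have h : Units.map (φ : _ →* _) u = v⁻¹ := Units.ext hφ
    have h' := congrArg Units.val (congrArg (·⁻¹) h)
    simpa using h'
  have hψ' : ψ ↑v⁻¹ = u := by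
    have h : Units.map (ψ : _ →* _) v = u⁻¹ := Units.ext hψ
    have h' := congrArg Units.val (congrArg (·⁻¹) h)
    simpa using h'
  refine ⟨AlgEquiv.ofAlgHom φ ψ (algHom_away_eq_id _ _ ?_) (algHom_away_eq_id _ _ ?_), ?_⟩
  · rw [← hv, AlgHom.comp_apply, hψ, hφ']
  · rw [← hu, AlgHom.comp_apply, hφ, hψ']
  · rw [AlgEquiv.ofAlgHom_apply, ← hu, ← hv, hφ, Units.inv_mul]
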